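/- Let K be a field. Let (P_1,…,P_p) and (Q_1,…,Q_q) be families of non-isotropic matrices with P_k ∈ GL_{n_k}(K) and Q_j ∈ GL_{m_j}(K), where n_1+⋯+n_p = m_1+⋯+m_q = n. Then P_1·Alt_{n_1}(K) ∨ ⋯ ∨ P_p·Alt_{n_p}(K) is similar to Q_1·Alt_{m_1}(K) ∨ ⋯ ∨ Q_q·Alt_{m_q}(K) if and only if q = p, n_k = m_k for every k ∈ {1,…,p}, and P_k is congruent to a non-zero scalar multiple of Q_k for every k ∈ {1,…,p}. -/

import Mathlib

open Matrix

/-- The set of alternate matrices: those `A` with `Xᵀ A X = 0` for all `X`. -/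
def altSet (K : Type*) [Field K] (n : ℕ) : Set (Matrix (Fin n) (Fin n) K) :=
  {A | ∀ X : Fin n → K, X ⬝ᵥ A.mulVec X = 0}

/-- A matrix `P` is non-isotropic if `Xᵀ P X ≠ 0` for every non-zero `X`. -/
def nonIsotropic {K : Type*} [Field K] {n : ℕ} (P : Matrix (Fin n) (Fin n) K) : Prop :=
  ∀ X : Fin n → K, X ≠ 0 → X ⬝ᵥ P.mulVec X ≠ 0

/-- `V ∨ W`: block upper-triangular matrices with diagonal blocks in `V` and `W` and
arbitrary upper-right block. -/
def blockJoin {K : Type*} [Field K] {n p : ℕ}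
    (V : Set (Matrix (Fin n) (Fin n) K)) (W : Set (Matrix (Fin p) (Fin p) K)) :
    Set (Matrix (Fin (n + p)) (Fin (n + p)) K) :=
  {M | ∃ A ∈ V, ∃ C ∈ W, ∃ B : Matrix (Fin n) (Fin p) K,
    M = Matrix.reindex finSumFinEquiv finSumFinEquiv (Matrix.fromBlocks A B 0 C)}

/-- Sum of the sizes in a list of (size, matrix) pairs. -/
def sigSum {β : ℕ → Type*} : List (Σ m : ℕ, β m) → ℕ
  | [] => 0
  | x :: xs => x.1 + sigSum xs

/-- `P_1·Alt_{n_1}(K) ∨ ⋯ ∨ P_p·Alt_{n_p}(K)` for a list of pairs `(n_k, P_k)`. -/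
def bdSet {K : Type*} [Field K] :
    (l : List (Σ m : ℕ, Matrix (Fin m) (Fin m) K)) →
      Set (Matrix (Fin (sigSum l)) (Fin (sigSum l)) K)
  | [] => Set.univ
  | x :: xs => blockJoin ((fun A => x.2 * A) '' altSet K x.1) (bdSet xs)

/-- Two subspaces of `M_n(K)` are similar if one is obtained from the other by conjugation. -/
def SimilarSets {K : Type*} [Field K] {n : ℕ}
    (V W : Set (Matrix (Fin n) (Fin n) K)) : Prop :=
  ∃ R : Matrix (Fin n) (Fin n) K, IsUnit R ∧ W = (fun M => R * M * R⁻¹) '' V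

/-- The two pairs have the same size, and the matrices are congruent up to a non-zero
scalar. -/
def congrScalar {K : Type*} [Field K] (x y : Σ m : ℕ, Matrix (Fin m) (Fin m) K) : Prop :=
  ∃ h : x.1 = y.1, ∃ c : K, c ≠ 0 ∧ ∃ R : Matrix (Fin x.1) (Fin x.1) K, IsUnit R ∧
    Matrix.reindex (finCongr h.symm) (finCongr h.symm) y.2 = c • (R * x.2 * Rᵀ)

/-- Similarity of sets of square matrices indexed by possibly different types. -/
def SimilarIndexed {K : Type*} [Field K] {α β : Type*} [Fintype α] [DecidableEq α] [Fintype β]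
    [DecidableEq β] (V : Set (Matrix α α K)) (W : Set (Matrix β β K)) : Prop :=
  ∃ (R : Matrix β α K) (S : Matrix α β K), R * S = 1 ∧ S * R = 1 ∧
    (∀ M ∈ V, R * M * S ∈ W) ∧ (∀ N ∈ W, S * N * R ∈ V)

/-- Block upper-triangular matrices with diagonal blocks in `V` and `W`, indexed by a sum type. -/
def sumJoin {K : Type*} [Field K] {α β : Type*}
    (V : Set (Matrix α α K)) (W : Set (Matrix β β K)) : Set (Matrix (α ⊕ β) (α ⊕ β) K) :=
  {M | ∃ A ∈ V, ∃ C ∈ W, ∃ B : Matrix α β K, M = Matrix.fromBlocks A B 0 C}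

section

variable {K : Type*} [Field K]

namespace SimilarIndexed

variable {α β γ δ : Type*} [Fintype α] [DecidableEq α] [Fintype β] [DecidableEq β]
  [Fintype γ] [DecidableEq γ] [Fintype δ] [DecidableEq δ]
  {V : Set (Matrix α α K)} {W : Set (Matrix β β K)} {X : Set (Matrix γ γ K)}
  {Y : Set (Matrix δ δ K)}

theorem symm (h : SimilarIndexed V W) : SimilarIndexed W V := by
  obtain ⟨R, S, h1, h2, h3, h4⟩ := h
  exact ⟨S, R, h2, h1, h4, h3⟩

theorem trans (h : SimilarIndexed V W) (h' : SimilarIndexed W X) : SimilarIndexed V X := by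
  obtain ⟨R, S, h1, h2, h3, h4⟩ := h
  obtain ⟨R', S', h1', h2', h3', h4'⟩ := h'
  refine ⟨R' * R, S * S', ?_, ?_, fun M hM => ?_, fun N hN => ?_⟩
  · rw [Matrix.mul_assoc, ← Matrix.mul_assoc R, h1, Matrix.one_mul, h1']
  · rw [Matrix.mul_assoc, ← Matrix.mul_assoc S', h2', Matrix.one_mul, h2]
  · simpa only [Matrix.mul_assoc] using h3' _ (h3 M hM)
  · simpa only [Matrix.mul_assoc] using h4 _ (h4' N hN)

theorem reindex (e : α ≃ β) (V : Set (Matrix α α K)) :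
    SimilarIndexed V (Matrix.reindex e e '' V) := by
  have key : ∀ M : Matrix α α K, (1 : Matrix α α K).submatrix e.symm id * M *
      (1 : Matrix α α K).submatrix id e.symm = Matrix.reindex e e M := by
    intro M
    ext i j
    simp [Matrix.mul_apply, Matrix.one_apply]
  have hRS : (1 : Matrix α α K).submatrix e.symm id * (1 : Matrix α α K).submatrix id e.symm
      = 1 := by
    ext i j
    simp [Matrix.mul_apply, Matrix.one_apply]
  have hSR : (1 : Matrix α α K).submatrix id e.symm * (1 : Matrix α α K).submatrix e.symm id
      = 1 := by
    rw [Matrix.submatrix_mul_equiv]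
    simp
  refine ⟨_, _, hRS, hSR, fun M hM => ?_, ?_⟩
  · rw [key]
    exact ⟨M, hM, rfl⟩
  · rintro _ ⟨M, hM, rfl⟩
    rw [← key, ← Matrix.mul_assoc, ← Matrix.mul_assoc, hSR, Matrix.one_mul, Matrix.mul_assoc, hSR,
      Matrix.mul_one]
    exact hM

theorem sumJoin (h : SimilarIndexed V X) (h' : SimilarIndexed W Y) :
    SimilarIndexed (sumJoin V W) (sumJoin X Y) := by
  obtain ⟨R, S, h1, h2, h3, h4⟩ := h
  obtain ⟨R', S', h1', h2', h3', h4'⟩ := h'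
  refine ⟨Matrix.fromBlocks R 0 0 R', Matrix.fromBlocks S 0 0 S', ?_, ?_, ?_, ?_⟩
  · simp [Matrix.fromBlocks_multiply, h1, h1']
  · simp [Matrix.fromBlocks_multiply, h2, h2']
  · rintro _ ⟨A, hA, C, hC, B, rfl⟩
    refine ⟨_, h3 A hA, _, h3' C hC, R * B * S', ?_⟩
    simp [Matrix.fromBlocks_multiply]
  · rintro _ ⟨A, hA, C, hC, B, rfl⟩
    refine ⟨_, h4 A hA, _, h4' C hC, S * B * R', ?_⟩
    simp [Matrix.fromBlocks_multiply]

end SimilarIndexed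

theorem similarSets_iff_similarIndexed {n : ℕ} {V W : Set (Matrix (Fin n) (Fin n) K)} :
    SimilarSets V W ↔ SimilarIndexed V W := by
  constructor
  · rintro ⟨R, hR, rfl⟩
    have hd : IsUnit R.det := (Matrix.isUnit_iff_isUnit_det R).1 hR
    refine ⟨R, R⁻¹, Matrix.mul_nonsing_inv R hd, Matrix.nonsing_inv_mul R hd,
      fun M hM => ⟨M, hM, rfl⟩, ?_⟩
    rintro _ ⟨M, hM, rfl⟩
    simpa [Matrix.mul_assoc, Matrix.nonsing_inv_mul _ hd, Matrix.nonsing_inv_mul_cancel_left _ _ hd]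
      using hM
  · rintro ⟨R, S, h1, h2, h3, h4⟩
    have hS : R⁻¹ = S := Matrix.inv_eq_right_inv h1
    refine ⟨R, IsUnit.of_mul_eq_one S h1, ?_⟩
    rw [hS]
    ext N
    constructor
    · intro hN
      refine ⟨S * N * R, h4 N hN, ?_⟩
      calc R * (S * N * R) * S = (R * S) * N * (R * S) := by simp only [Matrix.mul_assoc]
        _ = N := by rw [h1, Matrix.one_mul, Matrix.mul_one]
    · rintro ⟨M, hM, rfl⟩
      exact h3 M hM

theorem blockJoin_eq_image {n p : ℕ} (V : Set (Matrix (Fin n) (Fin n) K))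
    (W : Set (Matrix (Fin p) (Fin p) K)) :
    blockJoin V W = Matrix.reindex finSumFinEquiv finSumFinEquiv '' sumJoin V W := by
  ext M
  constructor
  · rintro ⟨A, hA, C, hC, B, rfl⟩
    exact ⟨_, ⟨A, hA, C, hC, B, rfl⟩, rfl⟩
  · rintro ⟨_, ⟨A, hA, C, hC, B, rfl⟩, rfl⟩
    exact ⟨A, hA, C, hC, B, rfl⟩

theorem similarIndexed_blockJoin_iff {n p m q : ℕ} {V : Set (Matrix (Fin n) (Fin n) K)}
    {W : Set (Matrix (Fin p) (Fin p) K)} {X : Set (Matrix (Fin m) (Fin m) K)}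
    {Y : Set (Matrix (Fin q) (Fin q) K)} :
    SimilarIndexed (blockJoin V W) (blockJoin X Y) ↔
      SimilarIndexed (sumJoin V W) (sumJoin X Y) := by
  rw [blockJoin_eq_image, blockJoin_eq_image]
  have h1 := SimilarIndexed.reindex finSumFinEquiv (sumJoin V W)
  have h2 := SimilarIndexed.reindex finSumFinEquiv (sumJoin X Y)
  exact ⟨fun h => (h1.trans h).trans h2.symm, fun h => (h1.symm.trans h).trans h2⟩

theorem zero_mem_altSet (n : ℕ) : (0 : Matrix (Fin n) (Fin n) K) ∈ altSet K n := by
  intro X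
  simp

theorem zero_mem_bdSet (l : List (Σ m : ℕ, Matrix (Fin m) (Fin m) K)) : 0 ∈ bdSet l := by
  induction l with
  | nil => exact Set.mem_univ _
  | cons x xs ih =>
    refine ⟨0, ⟨0, zero_mem_altSet _, by simp⟩, 0, ih, 0, ?_⟩
    simp
    rfl

theorem mul_mul_transpose_mem_altSet {n : ℕ} {A : Matrix (Fin n) (Fin n) K} (hA : A ∈ altSet K n)
    (R : Matrix (Fin n) (Fin n) K) : R * A * Rᵀ ∈ altSet K n := by
  intro X
  have := hA (Rᵀ *ᵥ X)
  rwa [Matrix.dotProduct_mulVec, Matrix.vecMul_mulVec, ← Matrix.dotProduct_mulVec,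
    Matrix.mulVec_mulVec, Matrix.transpose_transpose] at this

theorem smul_mem_altSet {n : ℕ} {A : Matrix (Fin n) (Fin n) K} (hA : A ∈ altSet K n) (c : K) :
    c • A ∈ altSet K n := by
  intro X
  rw [Matrix.smul_mulVec, dotProduct_smul, hA X, smul_zero]

theorem vecMulVec_sub_mem_altSet {n : ℕ} (u v : Fin n → K) :
    Matrix.vecMulVec u v - Matrix.vecMulVec v u ∈ altSet K n := by
  intro X
  rw [Matrix.sub_mulVec, Matrix.vecMulVec_mulVec, Matrix.vecMulVec_mulVec, dotProduct_sub,
    dotProduct_comm v X, dotProduct_comm u X]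
  simp [dotProduct_smul, mul_comm]

/-- The orbit of a nonzero vector `x` under `P·Alt_n`, together with `x`, spans everything. -/
theorem exists_altSet_mulVec_add_smul {n : ℕ} {P : Matrix (Fin n) (Fin n) K} (hP : IsUnit P)
    (hP' : nonIsotropic P) {x : Fin n → K} (hx : x ≠ 0) (z : Fin n → K) :
    ∃ A ∈ altSet K n, ∃ c : K, (P * A) *ᵥ x + c • x = z := by
  have hd : IsUnit P.det := (Matrix.isUnit_iff_isUnit_det P).1 hP
  set w := P⁻¹ *ᵥ x with hw
  have hPw : P *ᵥ w = x := by
    rw [hw, Matrix.mulVec_mulVec, Matrix.mul_nonsing_inv P hd, Matrix.one_mulVec]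
  have hw0 : w ≠ 0 := by
    rintro h
    rw [h, Matrix.mulVec_zero] at hPw
    exact hx hPw.symm
  have hwx : w ⬝ᵥ x ≠ 0 := by
    have := hP' w hw0
    rwa [hPw] at this
  set c := (x ⬝ᵥ P⁻¹ *ᵥ z) / (w ⬝ᵥ x) with hc
  set y := P⁻¹ *ᵥ z - c • w with hy
  have hyx : y ⬝ᵥ x = 0 := by
    rw [hy, sub_dotProduct, smul_dotProduct, dotProduct_comm _ x, hc, smul_eq_mul,
      div_mul_cancel₀ _ hwx, sub_self]
  refine ⟨_, smul_mem_altSet (vecMulVec_sub_mem_altSet y w) (w ⬝ᵥ x)⁻¹, c, ?_⟩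
  rw [← Matrix.mulVec_mulVec, Matrix.smul_mulVec, Matrix.sub_mulVec, Matrix.vecMulVec_mulVec,
    Matrix.vecMulVec_mulVec, hyx]
  have : (w ⬝ᵥ x)⁻¹ • (MulOpposite.op (w ⬝ᵥ x) • y - MulOpposite.op (0 : K) • w) = y := by
    simp [smul_smul, hwx]
  rw [this, hy, Matrix.mulVec_sub, Matrix.mulVec_smul, hPw, Matrix.mulVec_mulVec,
    Matrix.mul_nonsing_inv P hd, Matrix.one_mulVec, sub_add_cancel]

theorem exists_sumJoin_mulVec_add_smul {n : ℕ} {P : Matrix (Fin n) (Fin n) K} (hP : IsUnit P)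
    (hP' : nonIsotropic P) {α : Type*} [Fintype α] [DecidableEq α] {V : Set (Matrix α α K)}
    (hV : 0 ∈ V) {x : Fin n ⊕ α → K} (hx : x ≠ 0) (z : Fin n → K) :
    ∃ M ∈ sumJoin ((fun A => P * A) '' altSet K n) V, ∃ c : K,
      M *ᵥ x + c • x = Sum.elim z 0 := by
  obtain ⟨x₁, x₂, rfl⟩ : ∃ x₁ x₂, x = Sum.elim x₁ x₂ := ⟨_, _, (Sum.elim_comp_inl_inr x).symm⟩
  by_cases h2 : x₂ = 0
  · subst h2
    have h1 : x₁ ≠ 0 := by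
      rintro rfl
      exact hx (by ext i; cases i <;> rfl)
    obtain ⟨A, hA, c, hc⟩ := exists_altSet_mulVec_add_smul hP hP' h1 z
    refine ⟨_, ⟨_, ⟨A, hA, rfl⟩, 0, hV, 0, rfl⟩, c, ?_⟩
    rw [Matrix.fromBlocks_mulVec]
    ext i
    cases i with
    | inl i => simpa using congrFun hc i
    | inr i => simp
  · obtain ⟨i, hi⟩ := Function.ne_iff.1 h2
    refine ⟨_, ⟨_, ⟨0, zero_mem_altSet n, rfl⟩, 0, hV,
      Matrix.vecMulVec z (Pi.single i (x₂ i)⁻¹), rfl⟩, 0, ?_⟩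
    rw [Matrix.fromBlocks_mulVec]
    ext j
    cases j with
    | inl j =>
      have hi' : x₂ i ≠ 0 := hi
      simp [Matrix.vecMulVec_mulVec, hi']
    | inr j => simp

/-- A similarity between two joins preserves the first block. -/
theorem toBlocks₂₁_eq_zero {n m : ℕ} {P : Matrix (Fin n) (Fin n) K}
    (hP : IsUnit P) (hP' : nonIsotropic P) (hm : 0 < m)
    {α β : Type*} [Fintype α] [DecidableEq α] [Fintype β] [DecidableEq β]
    {V : Set (Matrix α α K)} (hV : 0 ∈ V) {X : Set (Matrix (Fin m) (Fin m) K)}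
    {Y : Set (Matrix β β K)}
    {R : Matrix (Fin m ⊕ β) (Fin n ⊕ α) K} {S : Matrix (Fin n ⊕ α) (Fin m ⊕ β) K}
    (hRS : R * S = 1)
    (h : ∀ M ∈ sumJoin ((fun A => P * A) '' altSet K n) V, R * M * S ∈ sumJoin X Y) :
    R.toBlocks₂₁ = 0 := by
  set y : Fin m ⊕ β → K := Sum.elim (Pi.single ⟨0, hm⟩ 1) 0 with hy
  have hRx : R *ᵥ (S *ᵥ y) = y := by rw [Matrix.mulVec_mulVec, hRS, Matrix.one_mulVec]
  have hx : S *ᵥ y ≠ 0 := by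
    intro h0
    rw [h0, Matrix.mulVec_zero] at hRx
    have := congrFun hRx (Sum.inl ⟨0, hm⟩)
    simp [hy] at this
  ext i j
  obtain ⟨M, hM, c, hc⟩ := exists_sumJoin_mulVec_add_smul hP hP' hV hx (Pi.single j 1)
  obtain ⟨A, -, C, -, B, hN⟩ := h M hM
  have hz : R *ᵥ Sum.elim (Pi.single j 1) 0 = (R * M * S) *ᵥ y + c • y := by
    rw [← hc, Matrix.mulVec_add, Matrix.mulVec_smul, hRx]
    simp only [Matrix.mulVec_mulVec, Matrix.mul_assoc]
  rw [hN, hy, Matrix.fromBlocks_mulVec] at hz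
  have := congrFun hz (Sum.inr i)
  simpa [Matrix.mulVec, dotProduct, Matrix.toBlocks₂₁, Pi.single_apply] using this

/-- A similarity between two joins restricts to similarities between the diagonal blocks. -/
theorem SimilarIndexed.blocks {n m : ℕ} {P : Matrix (Fin n) (Fin n) K}
    {Q : Matrix (Fin m) (Fin m) K}
    (hn : 0 < n) (hP : IsUnit P) (hP' : nonIsotropic P)
    (hm : 0 < m) (hQ : IsUnit Q) (hQ' : nonIsotropic Q)
    {α β : Type*} [Fintype α] [DecidableEq α] [Fintype β] [DecidableEq β]
    {V : Set (Matrix α α K)} (hV : 0 ∈ V) {W : Set (Matrix β β K)} (hW : 0 ∈ W)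
    (h : SimilarIndexed (_root_.sumJoin ((fun A => P * A) '' altSet K n) V)
      (_root_.sumJoin ((fun A => Q * A) '' altSet K m) W)) :
    SimilarIndexed ((fun A => P * A) '' altSet K n) ((fun A => Q * A) '' altSet K m) ∧
      SimilarIndexed V W := by
  obtain ⟨R, S, h1, h2, h3, h4⟩ := h
  have hR := toBlocks₂₁_eq_zero hP hP' hm hV h1 h3
  have hS := toBlocks₂₁_eq_zero hQ hQ' hn hW h2 h4
  rw [← Matrix.fromBlocks_toBlocks R, ← Matrix.fromBlocks_toBlocks S, hR, hS] at h1 h2 h3 h4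
  rw [Matrix.fromBlocks_multiply, ← Matrix.fromBlocks_one, Matrix.fromBlocks_inj] at h1 h2
  obtain ⟨h11, -, -, h14⟩ := h1
  obtain ⟨h21, -, -, h24⟩ := h2
  simp only [Matrix.mul_zero, Matrix.zero_mul, add_zero, zero_add] at h11 h14 h21 h24
  have hP0 : (0 : Matrix (Fin n) (Fin n) K) ∈ (fun A => P * A) '' altSet K n :=
    ⟨0, zero_mem_altSet n, by simp⟩
  have hQ0 : (0 : Matrix (Fin m) (Fin m) K) ∈ (fun A => Q * A) '' altSet K m :=
    ⟨0, zero_mem_altSet m, by simp⟩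
  refine ⟨⟨_, _, h11, h21, fun A hA => ?_, fun A hA => ?_⟩,
    ⟨_, _, h14, h24, fun C hC => ?_, fun C hC => ?_⟩⟩
  · obtain ⟨A', hA', C', hC', B', e⟩ := h3 _ ⟨A, hA, 0, hV, 0, rfl⟩
    simp only [Matrix.fromBlocks_multiply, Matrix.fromBlocks_inj, Matrix.mul_zero,
      Matrix.zero_mul, add_zero] at e
    rwa [e.1]
  · obtain ⟨A', hA', C', hC', B', e⟩ := h4 _ ⟨A, hA, 0, hW, 0, rfl⟩
    simp only [Matrix.fromBlocks_multiply, Matrix.fromBlocks_inj, Matrix.mul_zero,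
      Matrix.zero_mul, add_zero] at e
    rwa [e.1]
  · obtain ⟨A', hA', C', hC', B', e⟩ := h3 _ ⟨0, hP0, C, hC, 0, rfl⟩
    simp only [Matrix.fromBlocks_multiply, Matrix.fromBlocks_inj, Matrix.mul_zero,
      Matrix.zero_mul, add_zero, zero_add] at e
    rwa [e.2.2.2]
  · obtain ⟨A', hA', C', hC', B', e⟩ := h4 _ ⟨0, hQ0, C, hC, 0, rfl⟩
    simp only [Matrix.fromBlocks_multiply, Matrix.fromBlocks_inj, Matrix.mul_zero,
      Matrix.zero_mul, add_zero, zero_add] at e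
    rwa [e.2.2.2]

/-- A matrix stabilizing the space of alternate matrices by left multiplication is scalar. -/
theorem eq_smul_one_of_mul_mem_altSet {n : ℕ} {T : Matrix (Fin n) (Fin n) K}
    (hT : ∀ A ∈ altSet K n, T * A ∈ altSet K n) : ∃ c : K, T = c • 1 := by
  have key : ∀ (u v X : Fin n → K),
      (X ⬝ᵥ T *ᵥ u) * (v ⬝ᵥ X) = (X ⬝ᵥ T *ᵥ v) * (u ⬝ᵥ X) := by
    intro u v X
    have := hT _ (vecMulVec_sub_mem_altSet u v) X
    rw [← Matrix.mulVec_mulVec, Matrix.sub_mulVec, Matrix.vecMulVec_mulVec,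
      Matrix.vecMulVec_mulVec, op_smul_eq_smul, op_smul_eq_smul, Matrix.mulVec_sub,
      Matrix.mulVec_smul, Matrix.mulVec_smul, dotProduct_sub, dotProduct_smul, dotProduct_smul,
      smul_eq_mul, smul_eq_mul] at this
    linear_combination this
  have hoff : ∀ i j, i ≠ j → T i j = 0 := by
    intro i j hij
    have := key (Pi.single j 1) (Pi.single i 1) (Pi.single i 1)
    simpa [hij, hij.symm] using this
  have hdiag : ∀ i j, T i i = T j j := by
    intro i j
    by_cases hij : i = j
    · rw [hij]
    have := key (Pi.single i 1) (Pi.single j 1) (Pi.single i 1 + Pi.single j 1)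
    simpa [hij, Ne.symm hij, add_dotProduct, hoff i j hij, hoff j i (Ne.symm hij)] using this
  rcases n with _ | n
  · exact ⟨0, by ext i; exact i.elim0⟩
  · refine ⟨T 0 0, ?_⟩
    ext i j
    by_cases hij : i = j
    · subst hij
      simp [hdiag i 0]
    · simp [hij, hoff i j hij]

theorem similarIndexed_mul_altSet_iff {n : ℕ} (hn : 0 < n) {P Q : Matrix (Fin n) (Fin n) K}
    (hP : IsUnit P) (hQ : IsUnit Q) :
    SimilarIndexed ((fun A => P * A) '' altSet K n) ((fun A => Q * A) '' altSet K n) ↔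
      ∃ c : K, c ≠ 0 ∧ ∃ R : Matrix (Fin n) (Fin n) K, IsUnit R ∧ Q = c • (R * P * Rᵀ) := by
  constructor
  · rintro ⟨R, S, h1, -, h3, -⟩
    have hR : IsUnit R := IsUnit.of_mul_eq_one S h1
    have hQd : IsUnit Q.det := (Matrix.isUnit_iff_isUnit_det Q).1 hQ
    have hRPR : IsUnit (R * P * Rᵀ) := (hR.mul hP).mul ((Matrix.isUnit_transpose R).2 hR)
    obtain ⟨c, hc⟩ := eq_smul_one_of_mul_mem_altSet (T := Q⁻¹ * (R * P * Rᵀ)) (by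
      intro A hA
      have hA' := mul_mul_transpose_mem_altSet hA Rᵀ
      rw [Matrix.transpose_transpose] at hA'
      obtain ⟨B, hB, e⟩ := h3 _ ⟨_, hA', rfl⟩
      have e' : Q * B = R * P * Rᵀ * A := by
        have e2 : Q * B = R * P * Rᵀ * A * (R * S) := by
          simpa only [Matrix.mul_assoc] using e
        rwa [h1, Matrix.mul_one] at e2
      rwa [Matrix.mul_assoc, ← e', Matrix.nonsing_inv_mul_cancel_left _ _ hQd])
    have hc' : R * P * Rᵀ = c • Q := by
      rw [← Matrix.mul_nonsing_inv_cancel_left Q (R * P * Rᵀ) hQd, hc]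
      simp
    have hc0 : c ≠ 0 := by
      rintro rfl
      rw [zero_smul] at hc'
      have : NeZero n := ⟨hn.ne'⟩
      exact not_isUnit_zero (hc' ▸ hRPR)
    exact ⟨c⁻¹, inv_ne_zero hc0, R, hR, by rw [hc', inv_smul_smul₀ hc0]⟩
  · rintro ⟨c, hc, R, hR, rfl⟩
    have hd : IsUnit R.det := (Matrix.isUnit_iff_isUnit_det R).1 hR
    have h1 : R * R⁻¹ = 1 := Matrix.mul_nonsing_inv R hd
    have h2 : R⁻¹ * R = 1 := Matrix.nonsing_inv_mul R hd
    have h1t : Rᵀ * (R⁻¹)ᵀ = 1 := by rw [← Matrix.transpose_mul, h2, Matrix.transpose_one]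
    refine ⟨R, R⁻¹, h1, h2, ?_, ?_⟩
    · rintro _ ⟨A, hA, rfl⟩
      refine ⟨_, smul_mem_altSet (mul_mul_transpose_mem_altSet hA (R⁻¹)ᵀ) c⁻¹, ?_⟩
      simp only [Matrix.transpose_transpose, Matrix.smul_mul, Matrix.mul_smul, smul_smul,
        inv_mul_cancel₀ hc, one_smul]
      calc R * P * Rᵀ * ((R⁻¹)ᵀ * A * R⁻¹) = R * P * (Rᵀ * (R⁻¹)ᵀ) * A * R⁻¹ := by
            simp only [Matrix.mul_assoc]
        _ = R * (P * A) * R⁻¹ := by rw [h1t, Matrix.mul_one]; simp only [Matrix.mul_assoc]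
    · rintro _ ⟨A, hA, rfl⟩
      have hA' := mul_mul_transpose_mem_altSet hA Rᵀ
      rw [Matrix.transpose_transpose] at hA'
      refine ⟨_, smul_mem_altSet hA' c, ?_⟩
      simp only [Matrix.smul_mul, Matrix.mul_smul]
      calc c • (P * (Rᵀ * A * R)) = c • ((R⁻¹ * R) * P * Rᵀ * A * R) := by
            rw [h2, Matrix.one_mul]; simp only [Matrix.mul_assoc]
        _ = c • (R⁻¹ * (R * P * Rᵀ * A) * R) := by simp only [Matrix.mul_assoc]

theorem congrScalar_iff_similarIndexed {x y : Σ m : ℕ, Matrix (Fin m) (Fin m) K}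
    (hx : 0 < x.1) (hx' : IsUnit x.2) (hy' : IsUnit y.2) :
    congrScalar x y ↔
      SimilarIndexed ((fun A => x.2 * A) '' altSet K x.1) ((fun A => y.2 * A) '' altSet K y.1) := by
  obtain ⟨n, P⟩ := x
  obtain ⟨m, Q⟩ := y
  by_cases hnm : n = m
  · subst hnm
    rw [similarIndexed_mul_altSet_iff hx hx' hy']
    exact ⟨fun ⟨_, h⟩ => h, fun h => ⟨rfl, h⟩⟩
  · refine ⟨fun ⟨h, _⟩ => absurd h hnm, fun ⟨R, S, h1, h2, _⟩ => absurd ?_ hnm⟩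
    simpa using Matrix.square_of_invertible S R h2 h1

theorem similarIndexed_bdSet_iff (l l' : List (Σ m : ℕ, Matrix (Fin m) (Fin m) K))
    (hl : ∀ x ∈ l, 0 < x.1 ∧ IsUnit x.2 ∧ nonIsotropic x.2)
    (hl' : ∀ x ∈ l', 0 < x.1 ∧ IsUnit x.2 ∧ nonIsotropic x.2) (hs : sigSum l = sigSum l') :
    SimilarIndexed (bdSet l) (bdSet l') ↔ List.Forall₂ congrScalar l l' := by
  induction l generalizing l' with
  | nil =>
    cases l' with
    | nil =>
      exact ⟨fun _ => .nil, fun _ => ⟨1, 1, by simp, by simp, fun _ _ => Set.mem_univ _,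
        fun _ _ => Set.mem_univ _⟩⟩
    | cons y ys =>
      have := (hl' y (by simp)).1
      simp only [sigSum] at hs
      omega
  | cons x xs ih =>
    cases l' with
    | nil =>
      have := (hl x (by simp)).1
      simp only [sigSum] at hs
      omega
    | cons y ys =>
      obtain ⟨hx0, hxu, hxi⟩ := hl x (by simp)
      obtain ⟨hy0, hyu, hyi⟩ := hl' y (by simp)
      have ih' := fun hs' => ih ys (fun z hz => hl z (by simp [hz]))
        (fun z hz => hl' z (by simp [hz])) hs'
      rw [List.forall₂_cons, congrScalar_iff_similarIndexed hx0 hxu hyu]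
      refine Iff.trans similarIndexed_blockJoin_iff ⟨fun h => ?_, fun ⟨h1, h2⟩ => ?_⟩
      · obtain ⟨h1, h2⟩ := h.blocks hx0 hxu hxi hy0 hyu hyi (zero_mem_bdSet xs) (zero_mem_bdSet ys)
        obtain ⟨hxy, -⟩ := (congrScalar_iff_similarIndexed hx0 hxu hyu).2 h1
        simp only [sigSum] at hs
        exact ⟨h1, (ih' (by omega)).1 h2⟩
      · obtain ⟨hxy, -⟩ := (congrScalar_iff_similarIndexed hx0 hxu hyu).2 h1
        simp only [sigSum] at hs
        exact h1.sumJoin ((ih' (by omega)).2 h2)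

end

/-- `P_1·Alt_{n_1}(K) ∨ ⋯ ∨ P_p·Alt_{n_p}(K)` is similar to
`Q_1·Alt_{m_1}(K) ∨ ⋯ ∨ Q_q·Alt_{m_q}(K)` if and only if `p = q`, `n_k = m_k` for all
`k`, and each `P_k` is congruent to a non-zero scalar multiple of `Q_k`. -/
theorem pAlt_blocks_similar_iff (K : Type*) [Field K] (n : ℕ)
    (l l' : List (Σ m : ℕ, Matrix (Fin m) (Fin m) K))
    (hl : ∀ x ∈ l, 0 < x.1 ∧ IsUnit x.2 ∧ nonIsotropic x.2)
    (hl' : ∀ x ∈ l', 0 < x.1 ∧ IsUnit x.2 ∧ nonIsotropic x.2)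
    (h : sigSum l = n) (h' : sigSum l' = n) :
    SimilarSets ((Matrix.reindex (finCongr h) (finCongr h)) '' bdSet l)
        ((Matrix.reindex (finCongr h') (finCongr h')) '' bdSet l') ↔
      List.Forall₂ congrScalar l l' := by
  subst h
  rw [similarSets_iff_similarIndexed, ← similarIndexed_bdSet_iff l l' hl hl' h'.symm]
  have h1 := SimilarIndexed.reindex (finCongr (rfl : sigSum l = sigSum l)) (bdSet l)
  have h2 := SimilarIndexed.reindex (finCongr h') (bdSet l')
  exact ⟨fun h => (h1.trans h).trans h2.symm, fun h => (h1.symm.trans h).trans h2⟩
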